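/- Let s ∈ ℝ^n with s ≠ 0, and let u be an eigenvector of H associated with the smallest eigenvalue λ_min[H], with ‖u‖₂ = 1 and N(u) ≤ 1, whose sign is chosen so that ⟨g + Hs, u⟩ ≤ 0. Assume λ_min[H] + σ ω(s) N(s) < 0, where ω(s) := 1 + (2/√3)√ψ(s) with ψ(s) := max[0, 1 + 2⟨g + Hs, u⟩/(σ N(s)²)]. Then there exists α > 0 such that m(s) − m(s + α N(s) u) ≥ (9/(16σ²)) · | λ_min[H] + σ ω(s) N(s) |³. -/

import Mathlib

open scoped RealInnerProductSpace

noncomputable section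

/-- Abbreviation for the Euclidean space `ℝ^n`. -/
abbrev E (n : ℕ) := EuclideanSpace ℝ (Fin n)

/-- `N` is a norm on `ℝ^n` (possibly non-smooth, e.g. `ℓ¹` or `ℓ∞`). -/
structure IsNorm (n : ℕ) (N : E n → ℝ) : Prop where
  add_le : ∀ x y, N (x + y) ≤ N x + N y
  smul : ∀ (c : ℝ) (x : E n), N (c • x) = |c| * N x
  eq_zero : ∀ x, N x = 0 → x = 0

/-- The dual norm `‖v‖_{N,1} := max_{N s = 1} ⟪v, s⟫`. -/
def dualNorm (n : ℕ) (N : E n → ℝ) (v : E n) : ℝ :=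
  sSup {t : ℝ | ∃ s, N s = 1 ∧ t = ⟪v, s⟫}

/-- The smallest eigenvalue of a symmetric operator `A`, as the infimum of the
Rayleigh quotient over the Euclidean unit sphere. -/
def lamMin (n : ℕ) (A : E n →L[ℝ] E n) : ℝ :=
  sInf {t : ℝ | ∃ v : E n, ‖v‖ = 1 ∧ t = ⟪A v, v⟫}

/-- The norm `‖H‖_{N,2} := max_{N s = 1} |⟪H s, s⟫|` of a symmetric operator induced by `N`. -/
def matNormN (n : ℕ) (N : E n → ℝ) (A : E n →L[ℝ] E n) : ℝ :=
  sSup {t : ℝ | ∃ v : E n, N v = 1 ∧ t = |⟪A v, v⟫|}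

/-- The regularized quadratic model
`m(s) = f₀ + ⟪g,s⟫ + (1/2)⟪Hs,s⟫ + (σ/6) N(s)³`. -/
def qm (n : ℕ) (N : E n → ℝ) (f0 : ℝ) (g : E n) (H : E n →L[ℝ] E n) (σ : ℝ)
    (s : E n) : ℝ :=
  f0 + ⟪g, s⟫ + (1 / 2) * ⟪H s, s⟫ + σ / 6 * N s ^ 3

theorem IsNorm.nonneg {n : ℕ} {N : E n → ℝ} (hN : IsNorm n N) (x : E n) : 0 ≤ N x := by
  have h0 : N 0 = 0 := by simpa using hN.smul 0 0
  have h1 : N (-x) = N x := by simpa using hN.smul (-1) x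
  have h2 := hN.add_le x (-x)
  rw [add_neg_cancel, h0, h1] at h2
  linarith

/-- Decrease of the model along a unit eigenvector of `H`. -/
theorem qm_sub_ge_of_eigenvector {n : ℕ} {N : E n → ℝ} (hN : IsNorm n N)
    (f0 : ℝ) (g : E n) (H : E n →L[ℝ] E n) (hH : ∀ x y : E n, ⟪H x, y⟫ = ⟪x, H y⟫)
    {σ : ℝ} (hσ : 0 < σ) (s : E n) {u : E n} {μ : ℝ} (hu : H u = μ • u) (hu2 : ‖u‖ = 1)
    (huN : N u ≤ 1) {t : ℝ} (ht : 0 ≤ t) :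
    t * (-(⟪g + H s, u⟫ + σ * N s ^ 2 / 2) - (μ + σ * N s) * t / 2 - σ * t ^ 2 / 6) ≤
      qm n N f0 g H σ s - qm n N f0 g H σ (s + t • u) := by
  have hle : N (s + t • u) ≤ N s + t := by
    have h := hN.add_le s (t • u)
    rw [hN.smul, abs_of_nonneg ht] at h
    nlinarith
  have hcube : N (s + t • u) ^ 3 ≤ (N s + t) ^ 3 :=
    pow_le_pow_left₀ (hN.nonneg _) hle 3
  have huu : ⟪u, u⟫ = (1 : ℝ) := by rw [real_inner_self_eq_norm_sq, hu2]; norm_num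
  have hus : ⟪u, s⟫ * μ = ⟪H s, u⟫ := by
    rw [hH s u, hu, inner_smul_right, real_inner_comm, mul_comm]
  have hquad : ⟪H (s + t • u), s + t • u⟫ = ⟪H s, s⟫ + 2 * t * ⟪H s, u⟫ + t ^ 2 * μ := by
    simp only [map_add, map_smul, hu, inner_add_left, inner_add_right, real_inner_smul_left,
      real_inner_smul_right, huu]
    linear_combination t * hus
  have hlin : ⟪g, s + t • u⟫ = ⟪g, s⟫ + t * ⟪g, u⟫ := by
    rw [inner_add_right, real_inner_smul_right]
  unfold qm
  rw [hquad, hlin, inner_add_left]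
  nlinarith [mul_le_mul_of_nonneg_left hcube hσ.le]

/-- eigen-step decrease when the second-order condition fails:
if `λ_min[H] + σω(s)N(s) < 0`, then some `α > 0` yields
`m(s) − m(s+αN(s)u) ≥ (9/(16σ²)) |λ_min[H] + σω(s)N(s)|³`. -/
theorem stmt17 {n : ℕ} (hn : 1 ≤ n) (N : E n → ℝ) (hN : IsNorm n N)
    (f0 : ℝ) (g : E n) (H : E n →L[ℝ] E n)
    (hH : ∀ x y : E n, ⟪H x, y⟫ = ⟪x, H y⟫)
    (σ : ℝ) (hσ : 0 < σ) (s : E n) (hs : s ≠ 0)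
    (u : E n) (hu : H u = lamMin n H • u) (hu2 : ‖u‖ = 1) (huN : N u ≤ 1)
    (hsign : ⟪g + H s, u⟫ ≤ 0)
    (hneg : lamMin n H +
        σ * (1 + 2 / Real.sqrt 3 *
          Real.sqrt (max 0 (1 + 2 * ⟪g + H s, u⟫ / (σ * N s ^ 2)))) * N s < 0) :
    ∃ α : ℝ, 0 < α ∧
      qm n N f0 g H σ s - qm n N f0 g H σ (s + (α * N s) • u) ≥
        9 / (16 * σ ^ 2) *
          |lamMin n H +
            σ * (1 + 2 / Real.sqrt 3 *
              Real.sqrt (max 0 (1 + 2 * ⟪g + H s, u⟫ / (σ * N s ^ 2)))) * N s| ^ 3 := by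
  have hr : 0 < N s := lt_of_le_of_ne (hN.nonneg s) fun h => hs (hN.eq_zero s h.symm)
  set r := N s with hr_def
  set G : ℝ := ⟪g + H s, u⟫ with hG
  set ψ : ℝ := max 0 (1 + 2 * G / (σ * r ^ 2)) with hψ
  set q := Real.sqrt ψ with hq
  set c := 2 / Real.sqrt 3 with hc
  have hc0 : 0 < c := by positivity
  have hc2 : c ^ 2 = 4 / 3 := by
    rw [hc, div_pow, Real.sq_sqrt (by norm_num)]; norm_num
  clear_value c
  have hq0 : 0 ≤ q := Real.sqrt_nonneg _
  have hq2 : q ^ 2 = ψ := Real.sq_sqrt (le_max_left _ _)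
  have hGle : G + σ * r ^ 2 / 2 ≤ σ * r ^ 2 * q ^ 2 / 2 := by
    have h : 1 + 2 * G / (σ * r ^ 2) ≤ q ^ 2 := hq2 ▸ le_max_right _ _
    have h' := mul_le_mul_of_nonneg_left h (show 0 ≤ σ * r ^ 2 / 2 by positivity)
    have e : σ * r ^ 2 / 2 * (1 + 2 * G / (σ * r ^ 2)) = G + σ * r ^ 2 / 2 := by
      field_simp
      ring
    linarith
  rw [abs_of_neg hneg]
  set δ := -(lamMin n H + σ * (1 + c * q) * r) with hδ
  have hδ0 : 0 < δ := by linarith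
  have hμ : lamMin n H + σ * r = -(δ + σ * c * q * r) := by rw [hδ]; ring
  have hcq : 0 ≤ c * q * r := by positivity
  obtain ⟨t, ht⟩ : ∃ t, t = 3 * δ / (2 * σ) + 3 / 2 * (c * q * r) := ⟨_, rfl⟩
  have hδt : 3 * δ / (2 * σ) ≤ t := by linarith
  have ht0 : 0 < t := lt_of_lt_of_le (by positivity) hδt
  refine ⟨t / r, div_pos ht0 hr, ?_⟩
  rw [div_mul_cancel₀ t hr.ne']
  refine le_trans ?_ (qm_sub_ge_of_eigenvector hN f0 g H hH hσ s hu hu2 huN ht0.le)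
  rw [← hr_def, ← hG, hμ]
  have hvertex : -(σ * r ^ 2 * q ^ 2 / 2) - -(δ + σ * c * q * r) * t / 2 - σ * t ^ 2 / 6 =
      3 * δ ^ 2 / (8 * σ) + 3 / 4 * (δ * (c * q * r)) := by
    rw [ht]
    field_simp
    linear_combination (288 * σ ^ 2 * q ^ 2 * r ^ 2) * hc2
  have hval : 3 * δ ^ 2 / (8 * σ) ≤
      -(G + σ * r ^ 2 / 2) - -(δ + σ * c * q * r) * t / 2 - σ * t ^ 2 / 6 := by
    have := mul_nonneg hδ0.le hcq
    linarith
  calc 9 / (16 * σ ^ 2) * δ ^ 3 = 3 * δ / (2 * σ) * (3 * δ ^ 2 / (8 * σ)) := by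
        field_simp
        norm_num
    _ ≤ _ := mul_le_mul hδt hval (by positivity) ht0.le
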